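/- (Theorem 6, cut-set outer bound) Suppose an (n, M_1,…,M_L) cascade code has expected average distortion E[(1/n) Σ_{i=1}^n d(Z_i, Ẑ_i)] ≤ D. Then for every l = 1,…,L, (1/n) log M_l ≥ R^FWZ_{Z, S_{𝓛_l} | S_{𝓛_l^c}}(D), where the function R^FWZ is evaluated for the single-letter triple X = (S_1,…,S_l), Y = (S_{l+1},…,S_L), Z = φ(S_1,…,S_L). Consequently, any rate tuple (R_1,…,R_L) that achieves distortion D satisfies R_l ≥ R^FWZ_{Z, S_{𝓛_l} | S_{𝓛_l^c}}(D) for all l. -/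

import Mathlib

namespace Cascade

structure FinPMF (Ω : Type) [Fintype Ω] where
  p : Ω → ℝ
  nonneg : ∀ ω, 0 ≤ p ω
  sum_one : ∑ ω, p ω = 1

variable {Ω : Type} [Fintype Ω]

/-- Probability that the random variable `X` takes the value `x`. -/
noncomputable def prob (μ : FinPMF Ω) {α : Type} [DecidableEq α] (X : Ω → α) (x : α) : ℝ :=
  ∑ ω ∈ Finset.univ.filter (fun ω => X ω = x), μ.p ω

/-- Expectation of a real random variable. -/
noncomputable def expect (μ : FinPMF Ω) (f : Ω → ℝ) : ℝ := ∑ ω, μ.p ω * f ω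

/-- Shannon entropy (base 2) of a finite-valued random variable. -/
noncomputable def entropy (μ : FinPMF Ω) {α : Type} [Fintype α] [DecidableEq α] (X : Ω → α) : ℝ :=
  -∑ x, prob μ X x * Real.logb 2 (prob μ X x)

/-- Conditional mutual information `I(X;Y|Z)` (base 2). -/
noncomputable def condMI (μ : FinPMF Ω) {α β γ : Type} [Fintype α] [DecidableEq α]
    [Fintype β] [DecidableEq β] [Fintype γ] [DecidableEq γ]
    (X : Ω → α) (Y : Ω → β) (Z : Ω → γ) : ℝ :=
  entropy μ (fun ω => (X ω, Z ω)) + entropy μ (fun ω => (Y ω, Z ω))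
    - entropy μ (fun ω => (X ω, Y ω, Z ω)) - entropy μ Z

/-- A cascade code: terminal `l` encodes its observed block together with the message
received from terminal `l-1` (messages are natural numbers; the message of terminal `l`
lies in `Fin (M l)`, and the initial message `m_0` is the constant `0`). -/
structure Code (L n : ℕ) (S : Fin L → Type) (Zhat : Type) where
  M : Fin L → ℕ
  M_pos : ∀ l, 0 < M l
  enc : (l : Fin L) → (Fin n → S l) → ℕ → Fin (M l)
  dec : ℕ → Fin n → Zhat

/-- `msg c s k` is the message `m_k` produced by terminal `k` (with `m_0 = 0`). -/
def msg {L n : ℕ} {S : Fin L → Type} {Zhat : Type} (c : Code L n S Zhat)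
    (s : ∀ l, Fin n → S l) : ℕ → ℕ
  | 0 => 0
  | k + 1 => if h : k < L then (c.enc ⟨k, h⟩ (s ⟨k, h⟩) (msg c s k) : ℕ) else msg c s k

/-- The i.i.d. pmf of `n` copies of the source tuple. -/
noncomputable def iidPMF {L : ℕ} {S : Fin L → Type} [∀ l, Fintype (S l)] (n : ℕ)
    (pS : (∀ l, S l) → ℝ) (h0 : ∀ s, 0 ≤ pS s) (h1 : ∑ s, pS s = 1) :
    FinPMF (Fin n → ∀ l, S l) where
  p ω := ∏ i, pS (ω i)
  nonneg ω := Finset.prod_nonneg fun i _ => h0 (ω i)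
  sum_one := by
    classical
    rw [← Fintype.piFinset_univ, ← Finset.prod_univ_sum (fun _ => Finset.univ) (fun _ s => pS s)]
    simp [h1]

/-- The reconstruction `Ẑ^n` produced by the code on source realization `ω`. -/
def reconstruct {L n : ℕ} {S : Fin L → Type} {Zhat : Type} (c : Code L n S Zhat)
    (ω : Fin n → ∀ l, S l) : Fin n → Zhat :=
  c.dec (msg c (fun l i => ω i l) L)

/-- Average per-letter distortion of the code on source realization `ω`. -/
noncomputable def avgDistortion {L n : ℕ} {S : Fin L → Type} {Zt Zhat : Type}
    (φ : (∀ l, S l) → Zt) (d : Zt → Zhat → ℝ) (c : Code L n S Zhat)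
    (ω : Fin n → ∀ l, S l) : ℝ :=
  (n : ℝ)⁻¹ * ∑ i, d (φ (ω i)) (reconstruct c ω i)

/-- The rate tuple `R` achieves distortion `D` for the cascade source coding problem. -/
def AchievesDistortion {L : ℕ} {S : Fin L → Type} [∀ l, Fintype (S l)]
    (pS : (∀ l, S l) → ℝ) (h0 : ∀ s, 0 ≤ pS s) (h1 : ∑ s, pS s = 1)
    {Zt Zhat : Type} (φ : (∀ l, S l) → Zt) (d : Zt → Zhat → ℝ)
    (R : Fin L → ℝ) (D : ℝ) : Prop :=
  ∀ ε : ℝ, 0 < ε → ∃ n : ℕ, 0 < n ∧ ∃ c : Code L n S Zhat,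
    (∀ l, Real.logb 2 (c.M l) / n ≤ R l + ε) ∧
    expect (iidPMF n pS h0 h1) (avgDistortion φ d c) ≤ D + ε



/-- Minimum expected distortion `ℰ(Z|Q)` for estimating the value `Zr` from the
observation `Q` by some function `f`. -/
noncomputable def calE {Ω : Type} [Fintype Ω] (μ : FinPMF Ω) {Zt Zhat : Type}
    [Fintype Zhat] [Nonempty Zhat] (d : Zt → Zhat → ℝ)
    {α : Type} (Q : Ω → α) (Zr : Ω → Zt) : ℝ :=
  ⨅ f : α → Zhat, expect μ (fun ω => d (Zr ω) (f (Q ω)))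

/-- The extension of a pmf `μ` by an auxiliary `U ∈ Fin m` generated from `X` through the
conditional pmf (kernel) `k`; this builds in the Markov chain `U −∘− X −∘− everything else`. -/
noncomputable def extendPMF {Ω : Type} [Fintype Ω] (μ : FinPMF Ω) {𝒳 : Type}
    (X : Ω → 𝒳) {m : ℕ} (k : 𝒳 → Fin m → ℝ)
    (hk0 : ∀ x u, 0 ≤ k x u) (hk1 : ∀ x, ∑ u, k x u = 1) : FinPMF (Ω × Fin m) where
  p := fun p => μ.p p.1 * k (X p.1) p.2
  nonneg := fun p => mul_nonneg (μ.nonneg _) (hk0 _ _)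
  sum_one := by
    rw [Fintype.sum_prod_type]
    simp_rw [← Finset.mul_sum, hk1, mul_one]
    exact μ.sum_one

/-- The Wyner-Ziv-type rate-distortion function `R^FWZ_{Z,X|Y}(D)` for lossy function
computation: the infimum of `I(X;U|Y)` over all finite auxiliary alphabets `Fin m` and all
auxiliaries `U` generated from `X` via a conditional pmf `k` (so that `U −∘− X −∘− (Y,Z)`
is a Markov chain) such that `ℰ(Z|(U,Y)) ≤ D`. -/
noncomputable def RFWZ {Ω 𝒳 𝒴 Zt : Type} [Fintype Ω] [Fintype 𝒳] [DecidableEq 𝒳]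
    [Fintype 𝒴] [DecidableEq 𝒴] {Zhat : Type} [Fintype Zhat] [Nonempty Zhat]
    (μ : FinPMF Ω) (X : Ω → 𝒳) (Y : Ω → 𝒴) (Zr : Ω → Zt) (d : Zt → Zhat → ℝ)
    (D : ℝ) : ℝ :=
  sInf { r : ℝ | ∃ (m : ℕ) (k : 𝒳 → Fin m → ℝ) (hk0 : ∀ x u, 0 ≤ k x u)
      (hk1 : ∀ x, ∑ u, k x u = 1),
      calE (extendPMF μ X k hk0 hk1) d (fun p => (p.2, Y p.1)) (fun p => Zr p.1) ≤ D ∧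
      r = condMI (extendPMF μ X k hk0 hk1) (fun p => X p.1) (fun p => p.2)
            (fun p => Y p.1) }

/-! ### Compactness of convex hulls in finite dimension -/

lemma isCompact_convexHull_aux {E : Type} [NormedAddCommGroup E] [NormedSpace ℝ E]
    [FiniteDimensional ℝ E] {s : Set E} (hs : IsCompact s) : IsCompact (convexHull ℝ s) := by
  classical
  rcases s.eq_empty_or_nonempty with rfl | ⟨s0, hs0⟩
  · simp
  set N := Module.finrank ℝ E + 1 with hN
  have hK : IsCompact ((fun p : (Fin N → ℝ) × (Fin N → E) => ∑ i, p.1 i • p.2 i) ''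
      (stdSimplex ℝ (Fin N) ×ˢ Set.pi Set.univ (fun _ => s))) := by
    apply IsCompact.image
    · exact (isCompact_stdSimplex ℝ (Fin N)).prod (isCompact_univ_pi fun _ => hs)
    · fun_prop
  convert hK using 1
  apply Set.Subset.antisymm
  · intro x hx
    obtain ⟨ι, _, z, w, hz, hai, hw, hw1, hx⟩ := eq_pos_convex_span_of_mem_convexHull hx
    have hcard : Fintype.card ι ≤ Fintype.card (Fin N) := by
      rw [Fintype.card_fin]
      exact hai.card_le_finrank_succ.trans (Nat.succ_le_succ (Submodule.finrank_le _))
    obtain ⟨e⟩ := Function.Embedding.nonempty_of_card_le hcard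
    refine ⟨(Function.extend e w 0, Function.extend e z (fun _ => s0)), ⟨⟨?_, ?_⟩, ?_⟩, ?_⟩
    · intro i
      by_cases h : ∃ a, e a = i
      · obtain ⟨a, rfl⟩ := h
        simp [e.injective.extend_apply, (hw a).le]
      · simp [Function.extend_apply' _ _ _ h]
    · rw [← hw1]
      symm
      apply Fintype.sum_of_injective e e.injective
      · intro i hi
        exact Function.extend_apply' _ _ _ (by simpa using hi)
      · intro i
        simp [e.injective.extend_apply]
    · intro i _
      by_cases h : ∃ a, e a = i
      · obtain ⟨a, rfl⟩ := h
        simp only [e.injective.extend_apply]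
        exact hz ⟨a, rfl⟩
      · simp only [Function.extend_apply' _ _ _ h]
        exact hs0
    · rw [← hx]
      symm
      apply Fintype.sum_of_injective e e.injective
      · intro i hi
        have : ¬ ∃ a, e a = i := by simpa using hi
        simp [Function.extend_apply' _ _ _ this]
      · intro i
        simp [e.injective.extend_apply]
  · rintro x ⟨⟨w, z⟩, ⟨hw, hz⟩, rfl⟩
    exact mem_convexHull_of_exists_fintype w z hw.1 hw.2 (fun i => hz i trivial) rfl

/-! ### Basic facts on probabilities and entropies -/

lemma prob_eq_ite (μ : FinPMF Ω) {α : Type} [DecidableEq α] (X : Ω → α) (x : α) :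
    prob μ X x = ∑ ω, if X ω = x then μ.p ω else 0 := by
  rw [prob, Finset.sum_filter]

lemma prob_nonneg (μ : FinPMF Ω) {α : Type} [DecidableEq α] (X : Ω → α) (x : α) :
    0 ≤ prob μ X x := Finset.sum_nonneg fun ω _ => μ.nonneg ω

lemma le_prob_self (μ : FinPMF Ω) {α : Type} [DecidableEq α] (X : Ω → α) (ω : Ω) :
    μ.p ω ≤ prob μ X (X ω) := by
  apply Finset.single_le_sum (f := μ.p) (fun ω _ => μ.nonneg ω)
  simp

/-- Change of variables. -/
lemma sum_prob_mul (μ : FinPMF Ω) {α : Type} [Fintype α] [DecidableEq α] (X : Ω → α)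
    (f : α → ℝ) : ∑ x, prob μ X x * f x = ∑ ω, μ.p ω * f (X ω) := by
  simp_rw [prob_eq_ite, Finset.sum_mul]
  rw [Finset.sum_comm]
  refine Finset.sum_congr rfl fun ω _ => ?_
  simp [ite_mul]

lemma sum_prob (μ : FinPMF Ω) {α : Type} [Fintype α] [DecidableEq α] (X : Ω → α) :
    ∑ x, prob μ X x = 1 := by
  have := sum_prob_mul μ X (fun _ => 1)
  simpa [μ.sum_one] using this

lemma entropy_eq (μ : FinPMF Ω) {α : Type} [Fintype α] [DecidableEq α] (X : Ω → α) :
    entropy μ X = -∑ ω, μ.p ω * Real.logb 2 (prob μ X (X ω)) := by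
  rw [entropy, sum_prob_mul μ X (fun x => Real.logb 2 (prob μ X x))]

lemma prob_congr (μ : FinPMF Ω) {α β : Type} [DecidableEq α] [DecidableEq β]
    (X : Ω → α) (Y : Ω → β) (x : α) (y : β) (h : ∀ ω, X ω = x ↔ Y ω = y) :
    prob μ X x = prob μ Y y := by
  simp_rw [prob_eq_ite, h]

/-- Entropy is invariant under relabelling. -/
lemma entropy_congr (μ : FinPMF Ω) {α β : Type} [Fintype α] [DecidableEq α] [Fintype β]
    [DecidableEq β] (X : Ω → α) (Y : Ω → β) (h : ∀ ω ω', X ω = X ω' ↔ Y ω = Y ω') :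
    entropy μ X = entropy μ Y := by
  rw [entropy_eq, entropy_eq]
  congr 1
  refine Finset.sum_congr rfl fun ω _ => ?_
  rw [prob_congr μ X Y (X ω) (Y ω) (fun ω' => h ω' ω)]

/-- `H(M | Y) ≤ log |M|`. -/
lemma entropy_cond_le (μ : FinPMF Ω) {m : ℕ} (hm : 0 < m) {β : Type} [Fintype β]
    [DecidableEq β] (M : Ω → Fin m) (Y : Ω → β) :
    entropy μ (fun ω => (M ω, Y ω)) - entropy μ Y ≤ Real.logb 2 m := by
  have hm' : (0 : ℝ) < m := by exact_mod_cast hm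
  have hl : 0 < Real.log 2 := Real.log_pos (by norm_num)
  set q := fun ω => prob μ (fun ω => (M ω, Y ω)) (M ω, Y ω) with hq
  set r := fun ω => prob μ Y (Y ω) with hr
  have h1 : entropy μ (fun ω => (M ω, Y ω)) - entropy μ Y
      = ∑ ω, μ.p ω * (Real.logb 2 (r ω) - Real.logb 2 (q ω)) := by
    rw [entropy_eq, entropy_eq]
    simp only [mul_sub, Finset.sum_sub_distrib, hq, hr]
    ring
  have h2 : ∀ ω, μ.p ω * (Real.logb 2 (r ω) - Real.logb 2 (q ω)) ≤
      μ.p ω * Real.logb 2 m + (Real.log 2)⁻¹ * ((m : ℝ)⁻¹ * (μ.p ω * (r ω / q ω)) - μ.p ω) := by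
    intro ω
    rcases (μ.nonneg ω).eq_or_lt with h | h
    · simp [← h]
    have hqp : 0 < q ω := h.trans_le (le_prob_self μ (fun ω => (M ω, Y ω)) ω)
    have hrp : 0 < r ω := h.trans_le (le_prob_self μ Y ω)
    have := Real.log_le_sub_one_of_pos (x := r ω / q ω / m) (by positivity)
    rw [Real.log_div (by positivity) (by positivity), Real.log_div (by positivity) (by positivity)]
      at this
    simp only [Real.logb]
    have e : μ.p ω * (Real.log m / Real.log 2) +
        (Real.log 2)⁻¹ * ((m : ℝ)⁻¹ * (μ.p ω * (r ω / q ω)) - μ.p ω)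
        - μ.p ω * (Real.log (r ω) / Real.log 2 - Real.log (q ω) / Real.log 2)
        = μ.p ω * (Real.log 2)⁻¹ * ((r ω / q ω / m - 1) -
          (Real.log (r ω) - Real.log (q ω) - Real.log m)) := by
      ring
    have : 0 ≤ μ.p ω * (Real.log 2)⁻¹ * ((r ω / q ω / m - 1) -
          (Real.log (r ω) - Real.log (q ω) - Real.log m)) :=
      mul_nonneg (by positivity) (by linarith)
    linarith
  have h3 : ∑ ω, μ.p ω * (r ω / q ω) ≤ m := by
    have := sum_prob_mul μ (fun ω => (M ω, Y ω))
      (fun p => prob μ Y p.2 / prob μ (fun ω => (M ω, Y ω)) p)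
    simp only [hq, hr]
    rw [← this]
    calc _ ≤ ∑ p : Fin m × β, prob μ Y p.2 := by
            refine Finset.sum_le_sum fun p _ => ?_
            rcases (prob_nonneg μ (fun ω => (M ω, Y ω)) p).eq_or_lt with h | h
            · rw [← h]; simpa using prob_nonneg μ Y p.2
            · rw [mul_div_cancel₀ _ h.ne']
      _ = m := by
            rw [Fintype.sum_prod_type]
            simp [sum_prob]
  rw [h1]
  refine (Finset.sum_le_sum fun ω _ => h2 ω).trans ?_
  rw [Finset.sum_add_distrib, ← Finset.sum_mul, ← Finset.mul_sum, Finset.sum_sub_distrib,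
    ← Finset.mul_sum, μ.sum_one, one_mul]
  have : (m : ℝ)⁻¹ * ∑ ω, μ.p ω * (r ω / q ω) ≤ 1 := by
    rw [inv_mul_le_iff₀ hm']; linarith
  have : (Real.log 2)⁻¹ * ((m : ℝ)⁻¹ * ∑ ω, μ.p ω * (r ω / q ω) - 1) ≤ 0 :=
    mul_nonpos_of_nonneg_of_nonpos (by positivity) (by linarith)
  linarith

/-! ### Product distributions -/

/-- Independence of coordinate `i` from the others. -/
lemma iid_split (μ : FinPMF Ω) {n : ℕ} (ν : FinPMF (Fin n → Ω))
    (hν : ∀ ω, ν.p ω = ∏ i, μ.p (ω i)) (i : Fin n) (H : Ω → (Fin n → Ω) → ℝ)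
    (hH : ∀ s ω s', H s (Function.update ω i s') = H s ω) :
    ∑ ω, ν.p ω * H (ω i) ω = ∑ s, μ.p s * ∑ ω, ν.p ω * H s ω := by
  obtain _ | n := n
  · exact i.elim0
  have key : ∀ K : (Fin (n + 1) → Ω) → ℝ, ∑ ω, ν.p ω * K ω
      = ∑ s, ∑ η : Fin n → Ω, μ.p s * (∏ j, μ.p (η j)) * K (i.insertNth s η) := by
    intro K
    rw [← (Fin.insertNthEquiv (fun _ => Ω) i).sum_comp, Fintype.sum_prod_type]
    refine Finset.sum_congr rfl fun s _ => Finset.sum_congr rfl fun η _ => ?_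
    rw [hν, Fin.prod_univ_succAbove _ i]
    simp [Fin.insertNthEquiv]
  have hins : ∀ s s' (η : Fin n → Ω), H s (i.insertNth (α := fun _ => Ω) s' η) = H s (i.insertNth (α := fun _ => Ω) s η) := by
    intro s s' η
    rw [← hH s (i.insertNth (α := fun _ => Ω) s' η) s]
    congr 1
    rw [Fin.update_insertNth]
  rw [key]
  refine Finset.sum_congr rfl fun s _ => ?_
  rw [key (H s)]
  have h2 : ∀ s' (η : Fin n → Ω), μ.p s' * (∏ j, μ.p (η j)) * H s (i.insertNth (α := fun _ => Ω) s' η)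
      = μ.p s' * (∏ j, μ.p (η j)) * H s (i.insertNth (α := fun _ => Ω) s η) := by
    intro s' η
    rw [hins s s' η]
  simp_rw [h2, Fin.insertNth_apply_same]
  simp_rw [mul_assoc, ← Finset.mul_sum]
  rw [← Finset.sum_mul, μ.sum_one, one_mul]

lemma iid_marginal (μ : FinPMF Ω) {n : ℕ} (ν : FinPMF (Fin n → Ω))
    (hν : ∀ ω, ν.p ω = ∏ i, μ.p (ω i)) (i : Fin n) (h : Ω → ℝ) :
    ∑ ω, ν.p ω * h (ω i) = ∑ s, μ.p s * h s := by
  rw [iid_split μ ν hν i (fun s _ => h s) (fun _ _ _ => rfl)]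
  refine Finset.sum_congr rfl fun s _ => ?_
  rw [← Finset.sum_mul, ν.sum_one, one_mul]

lemma iid_prob (μ : FinPMF Ω) {n : ℕ} (ν : FinPMF (Fin n → Ω))
    (hν : ∀ ω, ν.p ω = ∏ i, μ.p (ω i)) {τ : Type} [DecidableEq τ] (T : Ω → τ) (t : Fin n → τ) :
    prob ν (fun ω j => T (ω j)) t = ∏ j, prob μ T (t j) := by
  classical
  simp_rw [prob_eq_ite]
  rw [Finset.prod_univ_sum, Fintype.piFinset_univ]
  refine Finset.sum_congr rfl fun ω _ => ?_
  rw [hν]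
  by_cases h : (fun j => T (ω j)) = t
  · rw [if_pos h]
    refine Finset.prod_congr rfl fun j _ => ?_
    rw [if_pos (congrFun h j)]
  · rw [if_neg h]
    obtain ⟨j, hj⟩ := Function.ne_iff.mp h
    symm
    apply Finset.prod_eq_zero (Finset.mem_univ j)
    rw [if_neg hj]

lemma iid_entropy (μ : FinPMF Ω) {n : ℕ} (ν : FinPMF (Fin n → Ω))
    (hν : ∀ ω, ν.p ω = ∏ i, μ.p (ω i)) {τ : Type} [Fintype τ] [DecidableEq τ] (T : Ω → τ) :
    entropy ν (fun ω j => T (ω j)) = n * entropy μ T := by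
  rw [entropy_eq]
  have : ∀ ω, ν.p ω * Real.logb 2 (prob ν (fun ω j => T (ω j)) (fun j => T (ω j)))
      = ∑ j, ν.p ω * Real.logb 2 (prob μ T (T (ω j))) := by
    intro ω
    rw [← Finset.mul_sum]
    by_cases h : ν.p ω = 0
    · simp [h]
    congr 1
    rw [iid_prob μ ν hν]
    rw [Real.logb_prod]
    intro j _ h0
    apply h
    rw [hν]
    apply Finset.prod_eq_zero (Finset.mem_univ j)
    exact le_antisymm ((le_prob_self μ T (ω j)).trans h0.le) (μ.nonneg _)
  simp_rw [this]
  rw [Finset.sum_comm]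
  simp_rw [iid_marginal μ ν hν _ (fun s => Real.logb 2 (prob μ T (T s)))]
  rw [entropy_eq]
  simp

/-! ### The single-letter functionals -/

/-- Shorthand `-t log t`. -/
noncomputable def eta (t : ℝ) : ℝ := -(t * Real.logb 2 t)

lemma eta_continuous : Continuous eta := by
  have : eta = fun t => Real.negMulLog t / Real.log 2 := by
    funext t
    simp [eta, Real.negMulLog, Real.logb]
    ring
  rw [this]
  exact Real.continuous_negMulLog.div_const _

lemma eta_mul (a b : ℝ) : eta (a * b) = a * eta b + b * eta a := by
  unfold eta
  by_cases ha : a = 0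
  · simp [ha]
  by_cases hb : b = 0
  · simp [hb]
  rw [Real.logb_mul ha hb]
  ring

lemma entropy_eq_eta (μ : FinPMF Ω) {α : Type} [Fintype α] [DecidableEq α] (X : Ω → α) :
    entropy μ X = ∑ x, eta (prob μ X x) := by
  simp [entropy, eta]

section Single

set_option linter.unusedSectionVars false

variable {𝒳 𝒴 Zt Zhat : Type} [Fintype 𝒳] [DecidableEq 𝒳] [Fintype 𝒴] [DecidableEq 𝒴]

/-- Conditional-entropy functional. -/
noncomputable def Gf (μ : FinPMF Ω) (X : Ω → 𝒳) (Y : Ω → 𝒴) (w : 𝒳 → ℝ) : ℝ :=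
  ∑ y, (∑ x, eta (w x * prob μ (fun s => (X s, Y s)) (x, y))
    - eta (∑ x, w x * prob μ (fun s => (X s, Y s)) (x, y)))

/-- Distortion functional. -/
noncomputable def Ef (μ : FinPMF Ω) (X : Ω → 𝒳) (Y : Ω → 𝒴) (Zr : Ω → Zt) (d : Zt → Zhat → ℝ)
    (f : 𝒴 → Zhat) (w : 𝒳 → ℝ) : ℝ :=
  ∑ s, μ.p s * (w (X s) * d (Zr s) (f (Y s)))

lemma Gf_continuous (μ : FinPMF Ω) (X : Ω → 𝒳) (Y : Ω → 𝒴) : Continuous (Gf μ X Y) := by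
  unfold Gf
  have := eta_continuous
  fun_prop

lemma Ef_continuous (μ : FinPMF Ω) (X : Ω → 𝒳) (Y : Ω → 𝒴) (Zr : Ω → Zt) (d : Zt → Zhat → ℝ)
    (f : 𝒴 → Zhat) : Continuous (Ef μ X Y Zr d f) := by
  unfold Ef
  fun_prop

lemma Gf_smul (μ : FinPMF Ω) (X : Ω → 𝒳) (Y : Ω → 𝒴) (t : ℝ) (w : 𝒳 → ℝ) :
    Gf μ X Y (t • w) = t * Gf μ X Y w := by
  unfold Gf
  rw [Finset.mul_sum]
  refine Finset.sum_congr rfl fun y _ => ?_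
  simp only [Pi.smul_apply, smul_eq_mul, mul_assoc]
  simp_rw [← Finset.mul_sum, eta_mul t]
  rw [Finset.sum_add_distrib, ← Finset.mul_sum, ← Finset.sum_mul]
  ring

lemma Ef_smul (μ : FinPMF Ω) (X : Ω → 𝒳) (Y : Ω → 𝒴) (Zr : Ω → Zt) (d : Zt → Zhat → ℝ)
    (f : 𝒴 → Zhat) (t : ℝ) (w : 𝒳 → ℝ) :
    Ef μ X Y Zr d f (t • w) = t * Ef μ X Y Zr d f w := by
  unfold Ef
  rw [Finset.mul_sum]
  refine Finset.sum_congr rfl fun y _ => ?_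
  simp only [Pi.smul_apply, smul_eq_mul]
  ring

/-- Feasible pairs (distortion, conditional entropy). -/
def Feas (μ : FinPMF Ω) (X : Ω → 𝒳) (Y : Ω → 𝒴) (Zr : Ω → Zt) (d : Zt → Zhat → ℝ)
    (e g : ℝ) : Prop :=
  ∃ (U : Type) (_ : Fintype U) (w : U → 𝒳 → ℝ) (f : U → 𝒴 → Zhat),
    (∀ u x, 0 ≤ w u x) ∧ (∀ x, ∑ u, w u x = 1) ∧
    ∑ u, Ef μ X Y Zr d (f u) (w u) = e ∧ ∑ u, Gf μ X Y (w u) = g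

/-- The generating set. -/
def genSet (μ : FinPMF Ω) (X : Ω → 𝒳) (Y : Ω → 𝒴) (Zr : Ω → Zt) (d : Zt → Zhat → ℝ) :
    Set ((𝒳 → ℝ) × ℝ × ℝ) :=
  ⋃ f : 𝒴 → Zhat, (fun q => (q, Ef μ X Y Zr d f q, Gf μ X Y q)) '' stdSimplex ℝ 𝒳

lemma genSet_compact [Finite Zhat] (μ : FinPMF Ω) (X : Ω → 𝒳) (Y : Ω → 𝒴) (Zr : Ω → Zt)
    (d : Zt → Zhat → ℝ) : IsCompact (genSet μ X Y Zr d) := by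
  apply isCompact_iUnion
  intro f
  apply (isCompact_stdSimplex ℝ 𝒳).image
  have := Gf_continuous μ X Y
  have := Ef_continuous μ X Y Zr d f
  fun_prop

/-- The point attached to a pair. -/
noncomputable def pt (𝒳 : Type) [Fintype 𝒳] (e g : ℝ) : (𝒳 → ℝ) × ℝ × ℝ :=
  (Fintype.card 𝒳 : ℝ)⁻¹ • ((fun _ => 1), e, g)

lemma feas_iff [Nonempty 𝒳] (μ : FinPMF Ω) (X : Ω → 𝒳) (Y : Ω → 𝒴) (Zr : Ω → Zt)
    (d : Zt → Zhat → ℝ) (e g : ℝ) :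
    Feas μ X Y Zr d e g ↔ pt 𝒳 e g ∈ convexHull ℝ (genSet μ X Y Zr d) := by
  classical
  have hN : (0 : ℝ) < Fintype.card 𝒳 := by exact_mod_cast Fintype.card_pos
  set N : ℝ := (Fintype.card 𝒳 : ℝ) with hNdef
  constructor
  · rintro ⟨U, _, w, f, hw0, hw1, rfl, rfl⟩
    set x0 : 𝒳 := Classical.arbitrary 𝒳
    set T : U → ℝ := fun u => ∑ x, w u x with hT
    set q : U → 𝒳 → ℝ := fun u => if T u = 0 then Pi.single x0 1 else (T u)⁻¹ • w u with hq
    have hT0 : ∀ u, 0 ≤ T u := fun u => Finset.sum_nonneg fun x _ => hw0 u x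
    have hwq : ∀ u, w u = T u • q u := by
      intro u
      by_cases h : T u = 0
      · have := (Finset.sum_eq_zero_iff_of_nonneg (fun x _ => hw0 u x)).mp h
        funext x
        simp [h, this x (Finset.mem_univ x)]
      · simp [hq, h]
    have hqs : ∀ u, q u ∈ stdSimplex ℝ 𝒳 := by
      intro u
      by_cases h : T u = 0
      · simp only [hq, if_pos h]
        exact single_mem_stdSimplex ℝ x0
      · simp only [hq, if_neg h]
        refine ⟨fun x => mul_nonneg (inv_nonneg.mpr (hT0 u)) (hw0 u x), ?_⟩
        simp only [Pi.smul_apply, smul_eq_mul]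
        rw [← Finset.mul_sum]
        exact inv_mul_cancel₀ h
    have hTs : ∑ u, T u = N := by
      simp only [hT]
      rw [Finset.sum_comm]
      simp [hw1, hNdef]
    refine mem_convexHull_of_exists_fintype (fun u => N⁻¹ * T u)
      (fun u => (q u, Ef μ X Y Zr d (f u) (q u), Gf μ X Y (q u))) ?_ ?_ ?_ ?_
    · intro u
      exact mul_nonneg (inv_nonneg.mpr hN.le) (hT0 u)
    · rw [← Finset.mul_sum, hTs, inv_mul_cancel₀ hN.ne']
    · intro u
      exact Set.mem_iUnion.mpr ⟨f u, q u, hqs u, rfl⟩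
    · have h1 : ∀ u, (N⁻¹ * T u) • (q u, Ef μ X Y Zr d (f u) (q u), Gf μ X Y (q u))
          = N⁻¹ • (w u, Ef μ X Y Zr d (f u) (w u), Gf μ X Y (w u)) := by
        intro u
        rw [hwq u, Ef_smul, Gf_smul, mul_smul]
        rfl
      simp_rw [h1]
      rw [← Finset.smul_sum, pt]
      congr 1
      refine Prod.ext ?_ (Prod.ext ?_ ?_)
      · funext x
        simp [Prod.fst_sum, hw1]
      · simp [Prod.fst_sum, Prod.snd_sum]
      · simp [Prod.snd_sum]
  · intro h
    obtain ⟨U, _, t, z, ht0, ht1, hz, hsum⟩ := mem_convexHull_iff_exists_fintype.mp h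
    have hz' : ∀ u, ∃ (f : 𝒴 → Zhat) (q : 𝒳 → ℝ), q ∈ stdSimplex ℝ 𝒳 ∧
        (q, Ef μ X Y Zr d f q, Gf μ X Y q) = z u := by
      intro u
      obtain ⟨f, q, hq, h⟩ := Set.mem_iUnion.mp (hz u)
      exact ⟨f, q, hq, h⟩
    choose f q hq hqz using hz'
    have hs : ∑ u, (N * t u) • z u = ((fun _ => 1), e, g) := by
      simp_rw [mul_smul]
      rw [← Finset.smul_sum, hsum, pt, smul_smul, mul_inv_cancel₀ hN.ne', one_smul]
    simp_rw [← hqz] at hs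
    refine ⟨U, inferInstance, fun u => (N * t u) • q u, f, ?_, ?_, ?_, ?_⟩
    · intro u x
      exact mul_nonneg (mul_nonneg hN.le (ht0 u)) ((hq u).1 x)
    · intro x
      have := congrFun (congrArg Prod.fst hs) x
      simpa [Prod.fst_sum] using this
    · have := congrArg (fun p => p.2.1) hs
      simp_rw [Ef_smul]
      simpa [Prod.fst_sum, Prod.snd_sum] using this
    · have := congrArg (fun p => p.2.2) hs
      simp_rw [Gf_smul]
      simpa [Prod.fst_sum, Prod.snd_sum] using this

lemma sum_Gf (μ : FinPMF Ω) (X : Ω → 𝒳) (Y : Ω → 𝒴) {Ω' : Type} [Fintype Ω'] (ν : FinPMF Ω')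
    {U : Type} [Fintype U] [DecidableEq U] (A : Ω' → 𝒳) (V : Ω' → U) (B : Ω' → 𝒴)
    (k : 𝒳 → U → ℝ)
    (h : ∀ x u y, prob ν (fun ω => (A ω, V ω, B ω)) (x, u, y)
      = k x u * prob μ (fun s => (X s, Y s)) (x, y)) :
    ∑ u, Gf μ X Y (fun x => k x u) = entropy ν (fun ω => (A ω, V ω, B ω))
      - entropy ν (fun ω => (V ω, B ω)) := by
  have h2 : ∀ u y, prob ν (fun ω => (V ω, B ω)) (u, y)
      = ∑ x, k x u * prob μ (fun s => (X s, Y s)) (x, y) := by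
    intro u y
    simp_rw [← h, prob_eq_ite]
    rw [Finset.sum_comm]
    refine Finset.sum_congr rfl fun ω _ => ?_
    by_cases hh : V ω = u ∧ B ω = y
    · simp [hh.1, hh.2]
    · simp only [Prod.mk.injEq, hh, if_false, and_false, Finset.sum_const_zero]
  rw [entropy_eq_eta, entropy_eq_eta]
  simp only [Fintype.sum_prod_type, h, h2, Gf, Finset.sum_sub_distrib]
  congr 1
  rw [Finset.sum_comm]
  simp_rw [Finset.sum_comm (s := (Finset.univ : Finset U))]
  rw [Finset.sum_comm]

lemma ext_prob_fst (μ : FinPMF Ω) (X : Ω → 𝒳) {m : ℕ} (k : 𝒳 → Fin m → ℝ)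
    (hk0 : ∀ x u, 0 ≤ k x u) (hk1 : ∀ x, ∑ u, k x u = 1) {τ : Type} [DecidableEq τ]
    (T : Ω → τ) (t : τ) :
    prob (extendPMF μ X k hk0 hk1) (fun p => T p.1) t = prob μ T t := by
  simp_rw [prob_eq_ite, extendPMF]
  rw [Fintype.sum_prod_type]
  refine Finset.sum_congr rfl fun s _ => ?_
  by_cases h : T s = t
  · simp [h, ← Finset.mul_sum, hk1]
  · simp [h]

lemma condMI_ext (μ : FinPMF Ω) (X : Ω → 𝒳) (Y : Ω → 𝒴) {m : ℕ} (k : 𝒳 → Fin m → ℝ)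
    (hk0 : ∀ x u, 0 ≤ k x u) (hk1 : ∀ x, ∑ u, k x u = 1) :
    condMI (extendPMF μ X k hk0 hk1) (fun p => X p.1) (fun p => p.2) (fun p => Y p.1)
      = (entropy μ (fun s => (X s, Y s)) - entropy μ Y) - ∑ u, Gf μ X Y (fun x => k x u) := by
  have h := sum_Gf μ X Y (extendPMF μ X k hk0 hk1) (fun p => X p.1) (fun p => p.2)
    (fun p => Y p.1) k (by
      intro x u y
      simp_rw [prob_eq_ite, extendPMF]
      rw [Fintype.sum_prod_type, Finset.mul_sum]
      refine Finset.sum_congr rfl fun s _ => ?_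
      by_cases h : X s = x ∧ Y s = y
      · simp [h.1, h.2, mul_comm]
      · rw [Finset.sum_eq_zero]
        · simp [h]
        · intro v _
          rw [if_neg]
          simp only [Prod.mk.injEq]
          tauto)
  rw [h, condMI]
  have h1 : entropy (extendPMF μ X k hk0 hk1) (fun p => (X p.1, Y p.1))
      = entropy μ (fun s => (X s, Y s)) := by
    simp_rw [entropy_eq_eta, ext_prob_fst μ X k hk0 hk1 (fun s => (X s, Y s))]
  have h2 : entropy (extendPMF μ X k hk0 hk1) (fun p => Y p.1) = entropy μ Y := by
    simp_rw [entropy_eq_eta, ext_prob_fst μ X k hk0 hk1 Y]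
  rw [h1, h2]
  ring

lemma feas_bdd [Finite Zhat] [Nonempty 𝒳] (μ : FinPMF Ω) (X : Ω → 𝒳) (Y : Ω → 𝒴) (Zr : Ω → Zt)
    (d : Zt → Zhat → ℝ) : ∃ B : ℝ, ∀ e g, Feas μ X Y Zr d e g → g ≤ B := by
  have hN : (0 : ℝ) < Fintype.card 𝒳 := by exact_mod_cast Fintype.card_pos
  have hc := isCompact_convexHull_aux (genSet_compact μ X Y Zr d)
  obtain ⟨B, hB⟩ := hc.bddAbove_image (f := fun p => (Fintype.card 𝒳 : ℝ) * p.2.2)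
    (by fun_prop)
  refine ⟨B, fun e g h => ?_⟩
  have := hB (Set.mem_image_of_mem _ ((feas_iff μ X Y Zr d e g).mp h))
  simpa [pt, hN.ne'] using this

lemma RFWZ_le [Fintype Zhat] [Nonempty Zhat] [Nonempty 𝒳] (μ : FinPMF Ω) (X : Ω → 𝒳)
    (Y : Ω → 𝒴) (Zr : Ω → Zt) (d : Zt → Zhat → ℝ) (D e g : ℝ) (h : Feas μ X Y Zr d e g)
    (he : e ≤ D) :
    RFWZ μ X Y Zr d D ≤ (entropy μ (fun s => (X s, Y s)) - entropy μ Y) - g := by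
  classical
  obtain ⟨B, hB⟩ := feas_bdd μ X Y Zr d
  apply csInf_le
  · refine ⟨(entropy μ (fun s => (X s, Y s)) - entropy μ Y) - B, ?_⟩
    rintro r ⟨m, k, hk0, hk1, -, rfl⟩
    rw [condMI_ext]
    have := hB _ _ ⟨Fin m, inferInstance, fun u x => k x u, fun _ _ => Classical.arbitrary _,
      fun u x => hk0 x u, hk1, rfl, rfl⟩
    linarith
  · obtain ⟨U, _, w, f, hw0, hw1, rfl, rfl⟩ := h
    let E := (Fintype.equivFin U).symm
    have hk1 : ∀ x, ∑ u, w (E u) x = 1 := by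
      intro x
      rw [← hw1 x]
      exact E.sum_comp (fun u => w u x)
    refine ⟨Fintype.card U, fun x u => w (E u) x, fun x u => hw0 _ _, hk1, ?_, ?_⟩
    · refine le_trans (ciInf_le (Set.finite_range _).bddBelow (fun q => f (E q.1) q.2)) ?_
      refine le_trans (le_of_eq ?_) he
      simp only [expect, extendPMF, Ef]
      rw [Fintype.sum_prod_type]
      simp only
      rw [Finset.sum_comm, ← E.sum_comp]
      refine Finset.sum_congr rfl fun u _ => Finset.sum_congr rfl fun s _ => ?_
      ring
    · rw [condMI_ext]
      congr 1
      exact (E.sum_comp (fun u => Gf μ X Y (w u))).symm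

lemma feas_limit [Finite Zhat] [Nonempty 𝒳] (μ : FinPMF Ω) (X : Ω → 𝒳)
    (Y : Ω → 𝒴) (Zr : Ω → Zt) (d : Zt → Zhat → ℝ) (D C R : ℝ)
    (h : ∀ ε : ℝ, 0 < ε → ∃ e g, Feas μ X Y Zr d e g ∧ e ≤ D + ε ∧ C - g ≤ R + ε) :
    ∃ e g, Feas μ X Y Zr d e g ∧ e ≤ D ∧ C - g ≤ R := by
  have hN : (0 : ℝ) < Fintype.card 𝒳 := by exact_mod_cast Fintype.card_pos
  set N : ℝ := (Fintype.card 𝒳 : ℝ) with hNdef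
  have hc := isCompact_convexHull_aux (genSet_compact μ X Y Zr d)
  have hcl : IsClosed {p : (𝒳 → ℝ) × ℝ × ℝ | p.1 = fun _ => N⁻¹} :=
    isClosed_eq continuous_fst continuous_const
  have hK := hc.inter_right hcl
  have hptmem : ∀ e g, Feas μ X Y Zr d e g →
      pt 𝒳 e g ∈ convexHull ℝ (genSet μ X Y Zr d) ∩ {p | p.1 = fun _ => N⁻¹} := by
    intro e g hf
    refine ⟨(feas_iff μ X Y Zr d e g).mp hf, ?_⟩
    funext x
    simp [pt, hNdef]
  obtain ⟨e0, g0, hf0, -, -⟩ := h 1 one_pos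
  obtain ⟨p, ⟨hpc, hp1⟩, hmin⟩ := hK.exists_isMinOn ⟨_, hptmem _ _ hf0⟩
    (f := fun p => max (N * p.2.1 - D) (C - N * p.2.2 - R)) (by fun_prop)
  have hle : max (N * p.2.1 - D) (C - N * p.2.2 - R) ≤ 0 := by
    apply le_of_forall_pos_le_add
    intro ε hε
    obtain ⟨e, g, hf, he, hg⟩ := h ε hε
    refine (hmin (hptmem e g hf)).trans ?_
    simp only [pt, Prod.smul_snd, Prod.smul_fst, smul_eq_mul, ← hNdef]
    rw [mul_inv_cancel_left₀ hN.ne', mul_inv_cancel_left₀ hN.ne']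
    apply max_le <;> linarith
  refine ⟨N * p.2.1, N * p.2.2, ?_, ?_, ?_⟩
  · rw [feas_iff]
    convert hpc using 1
    refine Prod.ext ?_ (Prod.ext ?_ ?_)
    · rw [show p.1 = fun _ => N⁻¹ from hp1]
      funext x
      simp [pt, hNdef]
    · simp [pt, ← hNdef, hN.ne']
    · simp [pt, ← hNdef, hN.ne']
  · linarith [(le_max_left _ _).trans hle]
  · linarith [(le_max_right _ _).trans hle]

lemma feas_avg [Nonempty 𝒳] (μ : FinPMF Ω) (X : Ω → 𝒳)
    (Y : Ω → 𝒴) (Zr : Ω → Zt) (d : Zt → Zhat → ℝ) {n : ℕ} (hn : 0 < n) (e g : Fin n → ℝ)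
    (h : ∀ i, Feas μ X Y Zr d (e i) (g i)) :
    Feas μ X Y Zr d ((n : ℝ)⁻¹ * ∑ i, e i) ((n : ℝ)⁻¹ * ∑ i, g i) := by
  have hn' : (0 : ℝ) < n := by exact_mod_cast hn
  simp_rw [feas_iff] at h ⊢
  have := (convex_convexHull ℝ (genSet μ X Y Zr d)).sum_mem (t := Finset.univ)
    (w := fun _ : Fin n => (n : ℝ)⁻¹) (z := fun i => pt 𝒳 (e i) (g i))
    (fun _ _ => by positivity) (by simp [hn'.ne']) (fun i _ => h i)
  convert this using 1
  simp only [pt]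
  rw [← Finset.smul_sum, ← Finset.smul_sum, smul_comm]
  congr 1
  refine Prod.ext ?_ (Prod.ext ?_ ?_)
  · funext x
    simp [Prod.fst_sum, hn'.ne']
  · simp [Prod.fst_sum, Prod.snd_sum]
  · simp [Prod.fst_sum, Prod.snd_sum]

/-- Feasibility of the auxiliary random variable attached to coordinate `i`. -/
lemma feas_letter (μ : FinPMF Ω) (X : Ω → 𝒳)
    (Y : Ω → 𝒴) (Zr : Ω → Zt) (d : Zt → Zhat → ℝ) {n : ℕ} (ν : FinPMF (Fin n → Ω))
    (hν : ∀ ω, ν.p ω = ∏ i, μ.p (ω i)) (i : Fin n) {U : Type} [Fintype U] [DecidableEq U]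
    (F : 𝒳 → (Fin n → Ω) → U) (hF : ∀ x ω s, F x (Function.update ω i s) = F x ω)
    (f : U → 𝒴 → Zhat) :
    Feas μ X Y Zr d
      (∑ ω, ν.p ω * d (Zr (ω i)) (f (F (X (ω i)) ω) (Y (ω i))))
      (entropy ν (fun ω => (X (ω i), F (X (ω i)) ω, Y (ω i)))
        - entropy ν (fun ω => (F (X (ω i)) ω, Y (ω i)))) := by
  refine ⟨U, inferInstance, fun u x => prob ν (F x) u, f, fun u x => prob_nonneg _ _ _,
    fun x => sum_prob _ _, ?_, ?_⟩
  · rw [iid_split μ ν hν i (fun s ω => d (Zr s) (f (F (X s) ω) (Y s)))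
      (fun s ω s' => by rw [hF])]
    simp only [Ef]
    rw [Finset.sum_comm]
    refine Finset.sum_congr rfl fun s _ => ?_
    rw [← Finset.mul_sum, sum_prob_mul ν (F (X s)) (fun u => d (Zr s) (f u (Y s)))]
  · apply sum_Gf μ X Y ν (fun ω => X (ω i)) (fun ω => F (X (ω i)) ω) (fun ω => Y (ω i))
      (fun x u => prob ν (F x) u)
    intro x u y
    have := iid_split μ ν hν i
      (fun s ω => if (X s, F (X s) ω, Y s) = (x, u, y) then 1 else 0)
      (fun s ω s' => by rw [hF])
    simp only [mul_ite, mul_one, mul_zero] at this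
    rw [prob_eq_ite, this, prob_eq_ite μ, Finset.mul_sum]
    refine Finset.sum_congr rfl fun s _ => ?_
    by_cases h : X s = x ∧ Y s = y
    · simp [h.1, h.2, prob_eq_ite, mul_comm]
    · have h' : ¬ (Y s = y ∧ X s = x) := fun hh => h hh.symm
      rw [if_neg (by simpa using h), mul_zero]
      rw [Finset.sum_eq_zero, mul_zero]
      intro ω _
      rw [if_neg]
      simp only [Prod.mk.injEq]
      tauto

lemma mask_eq_iff {n : ℕ} {τ : Type} (P : Fin n → Prop) [DecidablePred P] (a b : Fin n → τ) :
    ((fun j => if P j then some (a j) else none) = fun j => if P j then some (b j) else none)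
      ↔ ∀ j, P j → a j = b j := by
  rw [funext_iff]
  refine forall_congr' fun j => ?_
  by_cases h : P j <;> simp [h]

/-- The `n`-letter converse. -/
lemma block_converse [Nonempty 𝒳] (μ : FinPMF Ω) (X : Ω → 𝒳)
    (Y : Ω → 𝒴) (Zr : Ω → Zt) (d : Zt → Zhat → ℝ) {n : ℕ} (hn : 0 < n) (ν : FinPMF (Fin n → Ω))
    (hν : ∀ ω, ν.p ω = ∏ i, μ.p (ω i)) {m : ℕ} (hm : 0 < m) (gM : (Fin n → 𝒳) → Fin m)
    (dec : Fin m × (Fin n → 𝒴) → Fin n → Zhat) :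
    ∃ g, Feas μ X Y Zr d
      ((n : ℝ)⁻¹ * ∑ i, ∑ ω, ν.p ω * d (Zr (ω i))
        (dec (gM (fun j => X (ω j)), fun j => Y (ω j)) i)) g ∧
      (entropy μ (fun s => (X s, Y s)) - entropy μ Y) - g ≤ Real.logb 2 m / n := by
  letI instU : DecidableEq (Fin m × (Fin n → Option 𝒴) × (Fin n → Option 𝒳)) :=
    Classical.decEq _
  have hn' : (0 : ℝ) < n := by exact_mod_cast hn
  let F : Fin n → 𝒳 → (Fin n → Ω) → Fin m × (Fin n → Option 𝒴) × (Fin n → Option 𝒳) :=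
    fun i x ω => (gM (Function.update (fun j => X (ω j)) i x),
      (fun j => if j ≠ i then some (Y (ω j)) else none),
      (fun j => if j.val < i.val then some (X (ω j)) else none))
  have hF : ∀ i x ω s, F i x (Function.update ω i s) = F i x ω := by
    intro i x ω s
    refine Prod.ext ?_ (Prod.ext ?_ ?_)
    · simp only [F]
      congr 1
      funext j
      by_cases h : j = i
      · subst h; simp
      · simp [h]
    · funext j
      by_cases h : j = i
      · subst h; simp [F]
      · simp [F, h]
    · funext j
      by_cases h : j = i
      · subst h; simp [F]
      · simp [F, h]
  have hFX : ∀ i ω, F i (X (ω i)) ω = (gM (fun j => X (ω j)),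
      (fun j => if j ≠ i then some (Y (ω j)) else none),
      (fun j => if j.val < i.val then some (X (ω j)) else none)) := by
    intro i ω
    simp only [F]
    congr 2
    funext j
    by_cases h : j = i
    · subst h; simp
    · simp [h]
  let f : Fin n → Fin m × (Fin n → Option 𝒴) × (Fin n → Option 𝒳) → 𝒴 → Zhat :=
    fun i u y => dec (u.1, fun j => (u.2.1 j).getD y) i
  have hf : ∀ i ω, f i (F i (X (ω i)) ω) (Y (ω i))
      = dec (gM (fun j => X (ω j)), fun j => Y (ω j)) i := by
    intro i ω
    rw [hFX]
    simp only [f]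
    congr 3
    funext j
    by_cases h : j = i
    · subst h; simp
    · simp [h]
  let T : ℕ → ℝ := fun k => entropy ν (fun ω => (gM (fun j => X (ω j)), (fun j => Y (ω j)),
      (fun j : Fin n => if j.val < k then some (X (ω j)) else none)))
  have hT0 : ∀ i : Fin n, entropy ν (fun ω => (F i (X (ω i)) ω, Y (ω i))) = T i.val := by
    intro i
    apply entropy_congr
    intro ω ω'
    simp only [hFX, Prod.mk.injEq, mask_eq_iff, funext_iff (f := fun j => Y (ω j))]
    constructor
    · rintro ⟨⟨h1, h2, h3⟩, h4⟩
      refine ⟨h1, fun j => ?_, h3⟩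
      by_cases h : j = i
      · subst h; exact h4
      · exact h2 j h
    · rintro ⟨h1, h2, h3⟩
      exact ⟨⟨h1, fun j _ => h2 j, h3⟩, h2 i⟩
  have hT1 : ∀ i : Fin n, entropy ν (fun ω => (X (ω i), F i (X (ω i)) ω, Y (ω i)))
      = T (i.val + 1) := by
    intro i
    apply entropy_congr
    intro ω ω'
    simp only [hFX, Prod.mk.injEq, mask_eq_iff, funext_iff (f := fun j => Y (ω j))]
    constructor
    · rintro ⟨h0, ⟨h1, h2, h3⟩, h4⟩
      refine ⟨h1, fun j => ?_, fun j hj => ?_⟩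
      · by_cases h : j = i
        · subst h; exact h4
        · exact h2 j h
      · by_cases h : j = i
        · subst h; exact h0
        · refine h3 j ?_
          have : j.val ≠ i.val := fun hh => h (Fin.ext hh)
          omega
    · rintro ⟨h1, h2, h3⟩
      exact ⟨h3 i (Nat.lt_succ_self _), ⟨h1, fun j _ => h2 j, fun j hj => h3 j (by omega)⟩, h2 i⟩
  have hTn : T n = n * entropy μ (fun s => (X s, Y s)) := by
    rw [← iid_entropy μ ν hν]
    apply entropy_congr
    intro ω ω'
    simp only [Prod.mk.injEq, mask_eq_iff, funext_iff (f := fun j => Y (ω j)),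
      funext_iff (f := fun j => (X (ω j), Y (ω j)))]
    constructor
    · rintro ⟨h1, h2, h3⟩ j
      exact ⟨h3 j j.isLt, h2 j⟩
    · intro h
      refine ⟨?_, fun j => (h j).2, fun j _ => (h j).1⟩
      congr 1
      funext j
      exact (h j).1
  have hTz : T 0 = entropy ν (fun ω => (gM (fun j => X (ω j)), fun j => Y (ω j))) := by
    apply entropy_congr
    intro ω ω'
    simp
  have hsum : ∑ i : Fin n, (T (i.val + 1) - T i.val) = T n - T 0 := by
    rw [Fin.sum_univ_eq_sum_range (fun k => T (k + 1) - T k) n, Finset.sum_range_sub]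
  have hfe := feas_avg μ X Y Zr d hn _ _
    (fun i => feas_letter μ X Y Zr d ν hν i (F i) (hF i) (f i))
  simp only [hf, hT0, hT1, hsum] at hfe
  refine ⟨_, hfe, ?_⟩
  have hle := entropy_cond_le ν hm (fun ω => gM (fun j => X (ω j))) (fun ω j => Y (ω j))
  rw [← hTz, iid_entropy μ ν hν] at hle
  rw [hTn, le_div_iff₀ hn']
  have : ((entropy μ (fun s => (X s, Y s)) - entropy μ Y) -
      (n : ℝ)⁻¹ * (n * entropy μ (fun s => (X s, Y s)) - T 0)) * n
      = T 0 - n * entropy μ Y := by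
    field_simp
    ring
  rw [this]
  exact hle

end Single

lemma msg_congr {L n : ℕ} {S : Fin L → Type} {Zhat : Type} (c : Code L n S Zhat)
    (s s' : ∀ l, Fin n → S l) (k : ℕ) (h : ∀ j : Fin L, j.val < k → s j = s' j) :
    msg c s k = msg c s' k := by
  induction k with
  | zero => rfl
  | succ k ih =>
    have ih' := ih fun j hj => h j (by omega)
    simp only [msg]
    split_ifs with hk
    · rw [ih', h ⟨k, hk⟩ (Nat.lt_succ_self k)]
    · exact ih'

lemma msg_congr_from {L n : ℕ} {S : Fin L → Type} {Zhat : Type} (c : Code L n S Zhat)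
    (s s' : ∀ l, Fin n → S l) (k₀ : ℕ) (h₀ : msg c s k₀ = msg c s' k₀)
    (h : ∀ j : Fin L, k₀ ≤ j.val → s j = s' j) (k : ℕ) (hk : k₀ ≤ k) :
    msg c s k = msg c s' k := by
  induction k, hk using Nat.le_induction with
  | base => exact h₀
  | succ k hk ih =>
    simp only [msg]
    split_ifs with hkL
    · rw [ih, h ⟨k, hkL⟩ hk]
    · exact ih

/-- The converse for a cascade code. -/
lemma code_converse
    {L : ℕ} {S : Fin L → Type}
    [∀ l, Fintype (S l)] [∀ l, DecidableEq (S l)]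
    {Zt Zhat : Type} [Nonempty Zhat]
    (φ : (∀ j, S j) → Zt) (d : Zt → Zhat → ℝ)
    (pS : (∀ j, S j) → ℝ) (hpS0 : ∀ s, 0 ≤ pS s) (hpS1 : ∑ s, pS s = 1)
    (n : ℕ) (hn : 0 < n) (c : Code L n S Zhat) (l : Fin L)
    (X : (∀ j, S j) → ∀ j : Fin L, Option (S j)) (Y : (∀ j, S j) → ∀ j : Fin L, Option (S j))
    (hX : X = fun s => fun j : Fin L => if j ≤ l then some (s j) else none)
    (hY : Y = fun s => fun j : Fin L => if l < j then some (s j) else none)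
    (μ : FinPMF (∀ j, S j)) (hμ : μ = ⟨pS, hpS0, hpS1⟩) :
    ∃ g, Feas μ X Y φ d (expect (iidPMF n pS hpS0 hpS1) (avgDistortion φ d c)) g ∧
      (entropy μ (fun s => (X s, Y s)) - entropy μ Y) - g ≤ Real.logb 2 (c.M l) / n := by
  classical
  let M : (Fin n → ∀ j, S j) → Fin (c.M l) := fun ω =>
    c.enc l (fun i => ω i l) (msg c (fun l i => ω i l) l.val)
  have hMmsg : ∀ ω, msg c (fun l i => ω i l) (l.val + 1) = (M ω : ℕ) := by
    intro ω
    simp [msg, M]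
  have hXe : ∀ s s', X s = X s' → ∀ j : Fin L, j ≤ l → s j = s' j := by
    intro s s' h j hj
    have := congrFun h j
    simpa [hX, hj] using this
  have hYe : ∀ s s', Y s = Y s' → ∀ j : Fin L, l < j → s j = s' j := by
    intro s s' h j hj
    have := congrFun h j
    simpa [hY, hj] using this
  have hMf : Function.FactorsThrough M (fun ω j => X (ω j)) := by
    intro ω ω' h
    apply Fin.ext
    rw [← hMmsg, ← hMmsg]
    apply msg_congr
    intro j hj
    funext i
    exact hXe _ _ (congrFun h i) j (Fin.le_def.mpr (by omega))
  have hRf : Function.FactorsThrough (reconstruct c)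
      (fun ω => ((M ω, fun j => Y (ω j)) : Fin (c.M l) × (Fin n → ∀ j, Option (S j)))) := by
    intro ω ω' h
    simp only [Prod.mk.injEq] at h
    simp only [reconstruct]
    congr 1
    apply msg_congr_from c _ _ (l.val + 1)
    · rw [hMmsg, hMmsg, h.1]
    · intro j hj
      funext i
      exact hYe _ _ (congrFun h.2 i) j (Fin.lt_def.mpr (by omega))
    · exact l.isLt
  obtain ⟨g, hg, hle⟩ := block_converse μ X Y φ d hn (iidPMF n pS hpS0 hpS1)
    (by intro ω; rw [hμ]; rfl) (c.M_pos l)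
    (Function.extend (fun ω j => X (ω j)) M (fun _ => ⟨0, c.M_pos l⟩))
    (Function.extend (fun ω => ((M ω, fun j => Y (ω j)) :
      Fin (c.M l) × (Fin n → ∀ j, Option (S j)))) (reconstruct c)
      (fun _ _ => Classical.arbitrary _))
  refine ⟨g, ?_, hle⟩
  convert hg using 1
  have h1 : ∀ ω : Fin n → ∀ j, S j, Function.extend (fun (ω : Fin n → ∀ j, S j) j => X (ω j)) M
      (fun _ => ⟨0, c.M_pos l⟩) (fun j => X (ω j)) = M ω := fun ω => hMf.extend_apply _ ω
  have h2 : ∀ ω : Fin n → ∀ j, S j, Function.extend (fun ω => ((M ω, fun j => Y (ω j)) :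
      Fin (c.M l) × (Fin n → ∀ j, Option (S j)))) (reconstruct c)
      (fun _ _ => Classical.arbitrary _) (M ω, fun j => Y (ω j)) = reconstruct c ω :=
    fun ω => hRf.extend_apply _ ω
  simp_rw [h1, h2]
  simp only [expect, avgDistortion]
  rw [Finset.sum_comm, Finset.mul_sum]
  refine Finset.sum_congr rfl fun ω _ => ?_
  rw [← Finset.mul_sum]
  ring

/-- **Theorem 6 (cut-set outer bound).**
For any `(n, M_1,…,M_L)` cascade code whose expected average distortion is at most `D`,
every rate satisfies `(1/n) log M_l ≥ R^FWZ_{Z, S_{𝓛_l} | S_{𝓛_l^c}}(D)`, where the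
single-letter triple is `X = (S_1,…,S_l)` (masked tuple `fun j => if j ≤ l then some (s j)
else none`), `Y = (S_{l+1},…,S_L)` (masked tuple `fun j => if l < j then some (s j) else
none`) and `Z = φ(S_1,…,S_L)`.  Consequently, any rate tuple achieving distortion `D`
satisfies `R_l ≥ R^FWZ_{Z, S_{𝓛_l} | S_{𝓛_l^c}}(D)` for all `l`. -/
theorem cutset_outer_bound
    {L : ℕ} {S : Fin L → Type}
    [∀ l, Fintype (S l)] [∀ l, DecidableEq (S l)]
    {Zt Zhat : Type} [Fintype Zt] [Fintype Zhat] [Nonempty Zhat]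
    (φ : (∀ j, S j) → Zt) (d : Zt → Zhat → ℝ) (hd : ∀ z zh, 0 ≤ d z zh)
    (pS : (∀ j, S j) → ℝ) (hpS0 : ∀ s, 0 ≤ pS s) (hpS1 : ∑ s, pS s = 1) :
    (∀ (n : ℕ), 0 < n → ∀ (c : Code L n S Zhat) (D : ℝ),
        expect (iidPMF n pS hpS0 hpS1) (avgDistortion φ d c) ≤ D →
        ∀ l : Fin L,
          RFWZ (⟨pS, hpS0, hpS1⟩ : FinPMF (∀ j, S j))
            (fun s => fun j : Fin L => if j ≤ l then some (s j) else none)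
            (fun s => fun j : Fin L => if l < j then some (s j) else none)
            φ d D ≤ Real.logb 2 (c.M l) / n) ∧
    (∀ (R : Fin L → ℝ) (D : ℝ),
        AchievesDistortion pS hpS0 hpS1 φ d R D →
        ∀ l : Fin L,
          RFWZ (⟨pS, hpS0, hpS1⟩ : FinPMF (∀ j, S j))
            (fun s => fun j : Fin L => if j ≤ l then some (s j) else none)
            (fun s => fun j : Fin L => if l < j then some (s j) else none)
            φ d D ≤ R l) := by
  classical
  constructor
  · intro n hn c D hD l
    obtain ⟨g, hg, hle⟩ := code_converse φ d pS hpS0 hpS1 n hn c l _ _ rfl rfl _ rfl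
    exact (RFWZ_le _ _ _ _ _ D _ g hg hD).trans hle
  · intro R D hR l
    obtain ⟨e, g, hf, he, hg⟩ := feas_limit (⟨pS, hpS0, hpS1⟩ : FinPMF (∀ j, S j))
      (fun s => fun j : Fin L => if j ≤ l then some (s j) else none)
      (fun s => fun j : Fin L => if l < j then some (s j) else none) φ d D _ (R l) (by
        intro ε hε
        obtain ⟨n, hn, c, hr, hD⟩ := hR ε hε
        obtain ⟨g, hg, hle⟩ := code_converse φ d pS hpS0 hpS1 n hn c l _ _ rfl rfl _ rfl
        exact ⟨_, g, hg, hD, hle.trans (hr l)⟩)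
    exact (RFWZ_le _ _ _ _ _ D e g hf he).trans hg

end Cascade
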